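/- Under the setup of Proposition 2 (N twice-differentiable robot trajectories x_i with masses m_i > 0, local damping b_i ≥ 0, symmetric damping gains β_{i,j} = β_{j,i} ≥ 0 with nonnegative continuous scalings γ_{i,j}(t), a nonnegative even continuously differentiable pair potential V, differentiable symmetric coupling scalings α_{i,j}(t) with 0 < α_m ≤ α_{i,j}(t) ≤ α_M, and the scaled dynamics m_i x_i'' + b_i x_i' + Σ_{j≠i} α_{i,j}(t)∇V(x_i - x_j) + Σ_{j≠i} γ_{i,j}(t)β_{i,j}(x_i' - x_j') = F_i), for every T ≥ 0 the following intermediate inequality holds: ∫_0^T Σ_{i=1}^N ⟨F_i(τ), x_i'(τ)⟩ dτ ≥ Σ_{i=1}^N (m_i/2)(‖x_i'(T)‖² - ‖x_i'(0)‖²) + α_m Σ_{i<j} ∫_{{τ ∈ [0,T] : W_{i,j}'(τ) ≥ 0}} W_{i,j}'(τ) dτ + α_M Σ_{i<j} ∫_{{τ ∈ [0,T] : W_{i,j}'(τ) < 0}} W_{i,j}'(τ) dτ, where W_{i,j}(τ) = V(x_i(τ) - x_j(τ)). -/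

import Mathlib

open MeasureTheory Finset
open scoped RealInnerProductSpace

/-- The gradient of an even function is odd. -/
theorem gradient_neg_of_even {E : Type*} [NormedAddCommGroup E] [InnerProductSpace ℝ E]
    [CompleteSpace E] {V : E → ℝ} (hV : Differentiable ℝ V) (hVeven : ∀ y, V (-y) = V y) (y : E) :
    gradient V (-y) = -gradient V y := by
  have h1 := (hV (-y)).hasGradientAt.hasFDerivAt
  have h2 := h1.comp y (hasFDerivAt_id y).neg
  have h3 : V ∘ Neg.neg = V := funext fun z => hVeven z
  rw [h3] at h2
  have h4 := h2.unique (hV y).hasGradientAt.hasFDerivAt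
  refine ext_inner_right ℝ fun v => ?_
  have h5 := congrArg (fun L => L v) h4
  simp only [ContinuousLinearMap.comp_apply, neg_apply,
    ContinuousLinearMap.id_apply, InnerProductSpace.toDual_apply_apply, inner_neg_right] at h5
  rw [inner_neg_left]
  linarith

/-- The integral over the part of `[0, T]` where a continuous function is nonnegative is the
integral of its positive part. -/
theorem setIntegral_nonneg_eq_intervalIntegral_max {w : ℝ → ℝ} (hw : Continuous w) {T : ℝ}
    (hT : 0 ≤ T) :
    ∫ τ in {τ : ℝ | τ ∈ Set.Icc (0:ℝ) T ∧ 0 ≤ w τ}, w τ = ∫ τ in (0:ℝ)..T, max (w τ) 0 := by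
  have hs : MeasurableSet {τ : ℝ | 0 ≤ w τ} := measurableSet_le measurable_const hw.measurable
  have h : {τ : ℝ | τ ∈ Set.Icc (0:ℝ) T ∧ 0 ≤ w τ} = Set.Icc 0 T ∩ {τ : ℝ | 0 ≤ w τ} := rfl
  rw [h, ← setIntegral_indicator hs, integral_Icc_eq_integral_Ioc,
    intervalIntegral.integral_of_le hT]
  congr 1
  funext τ
  by_cases hτ : 0 ≤ w τ
  · simp [Set.indicator, hτ]
  · simp [Set.indicator, hτ, le_of_not_ge hτ]

/-- The integral over the part of `[0, T]` where a continuous function is negative is the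
integral of its minimum with zero. -/
theorem setIntegral_neg_eq_intervalIntegral_min {w : ℝ → ℝ} (hw : Continuous w) {T : ℝ}
    (hT : 0 ≤ T) :
    ∫ τ in {τ : ℝ | τ ∈ Set.Icc (0:ℝ) T ∧ w τ < 0}, w τ = ∫ τ in (0:ℝ)..T, min (w τ) 0 := by
  have hs : MeasurableSet {τ : ℝ | w τ < 0} := measurableSet_lt hw.measurable measurable_const
  have h : {τ : ℝ | τ ∈ Set.Icc (0:ℝ) T ∧ w τ < 0} = Set.Icc 0 T ∩ {τ : ℝ | w τ < 0} := rfl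
  rw [h, ← setIntegral_indicator hs, integral_Icc_eq_integral_Ioc,
    intervalIntegral.integral_of_le hT]
  congr 1
  funext τ
  by_cases hτ : w τ < 0
  · simp [Set.indicator, hτ, hτ.le]
  · simp [Set.indicator, hτ, le_of_not_gt hτ]

/-- A scaled real is bounded below by scaling its positive part with the least and its negative
part with the greatest admissible factor. -/
theorem mul_max_add_mul_min_le {a lo hi w : ℝ} (hlo : lo ≤ a) (hhi : a ≤ hi) :
    lo * max w 0 + hi * min w 0 ≤ a * w := by
  rcases le_total 0 w with h | h
  · rw [max_eq_left h, min_eq_right h]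
    nlinarith
  · rw [max_eq_right h, min_eq_left h]
    nlinarith

/-- A double sum over distinct indices, grouped by unordered pairs. -/
theorem sum_sum_filter_ne_eq_sum_sum_Ioi {N : ℕ} (f : Fin N → Fin N → ℝ) :
    ∑ i, ∑ j ∈ univ.filter (· ≠ i), f i j = ∑ i, ∑ j ∈ Ioi i, (f i j + f j i) := by
  rw [sum_sum_Ioi_add_eq_sum_sum_off_diag (fun j i => f i j)]
  refine sum_congr rfl fun i _ => sum_congr ?_ fun _ _ => rfl
  ext j
  simp

/-- Key intermediate inequality in the proof of Proposition 2: for the scaled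
multi-robot dynamics with `0 < α_m ≤ α_{i,j}(t) ≤ α_M`, for every `T ≥ 0`,
`∫_0^T Σ_i ⟨F_i, ẋ_i⟩ ≥ Σ_i (m_i/2)(‖ẋ_i(T)‖² - ‖ẋ_i(0)‖²)
+ α_m Σ_{i<j} ∫_{Ẇ_{i,j}≥0} Ẇ_{i,j} + α_M Σ_{i<j} ∫_{Ẇ_{i,j}<0} Ẇ_{i,j}`,
where `W_{i,j}(τ) = V(x_i(τ) - x_j(τ))`. -/
theorem stmt_10 (N : ℕ)
    (x x' x'' : Fin N → ℝ → EuclideanSpace ℝ (Fin 3))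
    (hx' : ∀ i t, HasDerivAt (x i) (x' i t) t)
    (hx'' : ∀ i t, HasDerivAt (x' i) (x'' i t) t)
    (m : Fin N → ℝ) (hm : ∀ i, 0 < m i)
    (b : Fin N → ℝ) (hb : ∀ i, 0 ≤ b i)
    (β : Fin N → Fin N → ℝ) (hβsymm : ∀ i j, β i j = β j i) (hβ : ∀ i j, 0 ≤ β i j)
    (γ : Fin N → Fin N → ℝ → ℝ) (hγsymm : ∀ i j, γ i j = γ j i)
    (hγcont : ∀ i j, Continuous (γ i j)) (hγ : ∀ i j t, 0 ≤ γ i j t)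
    (F : Fin N → ℝ → EuclideanSpace ℝ (Fin 3)) (hF : ∀ i, Continuous (F i))
    (V : EuclideanSpace ℝ (Fin 3) → ℝ) (hV : ContDiff ℝ 1 V)
    (hVnonneg : ∀ y, 0 ≤ V y) (hVeven : ∀ y, V (-y) = V y)
    (α α' : Fin N → Fin N → ℝ → ℝ) (hαsymm : ∀ i j, α i j = α j i)
    (hα' : ∀ i j t, HasDerivAt (α i j) (α' i j t) t)
    (αm αM : ℝ) (hαm : 0 < αm) (hmM : αm ≤ αM)
    (hαbound : ∀ i j t, αm ≤ α i j t ∧ α i j t ≤ αM)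
    (hdyn : ∀ i t, m i • x'' i t + b i • x' i t
        + (∑ j ∈ univ.filter (· ≠ i), α i j t • gradient V (x i t - x j t))
        + (∑ j ∈ univ.filter (· ≠ i), (γ i j t * β i j) • (x' i t - x' j t)) = F i t)
    (W : Fin N → Fin N → ℝ → ℝ) (hW : ∀ i j τ, W i j τ = V (x i τ - x j τ)) :
    ∀ T, 0 ≤ T →
      (∑ i, m i / 2 * (‖x' i T‖ ^ 2 - ‖x' i 0‖ ^ 2))
        + αm * (∑ i, ∑ j ∈ Ioi i,
            ∫ τ in {τ : ℝ | τ ∈ Set.Icc (0:ℝ) T ∧ 0 ≤ deriv (W i j) τ}, deriv (W i j) τ)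
        + αM * (∑ i, ∑ j ∈ Ioi i,
            ∫ τ in {τ : ℝ | τ ∈ Set.Icc (0:ℝ) T ∧ deriv (W i j) τ < 0}, deriv (W i j) τ)
        ≤ ∫ τ in (0:ℝ)..T, ∑ i, ⟪F i τ, x' i τ⟫ := by
  intro T hT
  have hVd : Differentiable ℝ V := hV.differentiable one_ne_zero
  have hxc : ∀ i, Continuous (x i) := fun i =>
    continuous_iff_continuousAt.2 fun t => (hx' i t).continuousAt
  have hx'c : ∀ i, Continuous (x' i) := fun i =>
    continuous_iff_continuousAt.2 fun t => (hx'' i t).continuousAt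
  have hαc : ∀ i j, Continuous (α i j) := fun i j =>
    continuous_iff_continuousAt.2 fun t => (hα' i j t).continuousAt
  have hgc : Continuous (gradient V) :=
    (InnerProductSpace.toDual ℝ (EuclideanSpace ℝ (Fin 3))).symm.continuous.comp
      (hV.continuous_fderiv one_ne_zero)
  have hmx : ∀ i t, m i • x'' i t = F i t - b i • x' i t
      - (∑ j ∈ univ.filter (· ≠ i), α i j t • gradient V (x i t - x j t))
      - (∑ j ∈ univ.filter (· ≠ i), (γ i j t * β i j) • (x' i t - x' j t)) := by
    intro i t
    rw [← hdyn i t]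
    abel
  have hmxc : ∀ i, Continuous fun t => m i • x'' i t := by
    intro i
    simp only [hmx]
    fun_prop
  have hWd : ∀ i j, deriv (W i j) =
      fun t => ⟪gradient V (x i t - x j t), x' i t - x' j t⟫ := by
    intro i j
    funext t
    have h := (hVd (x i t - x j t)).hasGradientAt.hasFDerivAt.comp_hasDerivAt t
      ((hx' i t).sub (hx' j t))
    have hWe : W i j = V ∘ (x i - x j) := funext (hW i j)
    rw [hWe]
    exact h.deriv
  have hWc : ∀ i j, Continuous (deriv (W i j)) := by
    intro i j
    rw [hWd]
    fun_prop
  have hpow : ∀ t, (∑ i, ⟪m i • x'' i t, x' i t⟫)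
      + (∑ i, ∑ j ∈ Ioi i,
          (αm * max (deriv (W i j) t) 0 + αM * min (deriv (W i j) t) 0))
      ≤ ∑ i, ⟪F i t, x' i t⟫ := by
    intro t
    have hsplit : ∑ i, ⟪F i t, x' i t⟫ = (∑ i, ⟪m i • x'' i t, x' i t⟫)
        + (∑ i, b i * ‖x' i t‖ ^ 2)
        + (∑ i, ∑ j ∈ univ.filter (· ≠ i),
            α i j t * ⟪gradient V (x i t - x j t), x' i t⟫)
        + (∑ i, ∑ j ∈ univ.filter (· ≠ i),
            γ i j t * β i j * ⟪x' i t - x' j t, x' i t⟫) := by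
      simp only [← sum_add_distrib]
      refine sum_congr rfl fun i _ => ?_
      rw [← hdyn i t]
      simp only [inner_add_left, sum_inner, real_inner_smul_left, real_inner_self_eq_norm_sq]
    rw [hsplit, sum_sum_filter_ne_eq_sum_sum_Ioi, sum_sum_filter_ne_eq_sum_sum_Ioi]
    have hlocal : 0 ≤ ∑ i, b i * ‖x' i t‖ ^ 2 :=
      sum_nonneg fun i _ => mul_nonneg (hb i) (sq_nonneg _)
    have hdamp : 0 ≤ ∑ i, ∑ j ∈ Ioi i, (γ i j t * β i j * ⟪x' i t - x' j t, x' i t⟫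
        + γ j i t * β j i * ⟪x' j t - x' i t, x' j t⟫) := by
      refine sum_nonneg fun i _ => sum_nonneg fun j _ => ?_
      have h : γ i j t * β i j * ⟪x' i t - x' j t, x' i t⟫
          + γ j i t * β j i * ⟪x' j t - x' i t, x' j t⟫
          = γ i j t * β i j * ⟪x' i t - x' j t, x' i t - x' j t⟫ := by
        rw [hγsymm j i, hβsymm j i, ← neg_sub (x' i t) (x' j t), inner_neg_left,
          inner_sub_right]
        ring
      rw [h]
      exact mul_nonneg (mul_nonneg (hγ i j t) (hβ i j)) real_inner_self_nonneg
    have hcoupling : (∑ i, ∑ j ∈ Ioi i,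
          (αm * max (deriv (W i j) t) 0 + αM * min (deriv (W i j) t) 0))
        ≤ ∑ i, ∑ j ∈ Ioi i, (α i j t * ⟪gradient V (x i t - x j t), x' i t⟫
          + α j i t * ⟪gradient V (x j t - x i t), x' j t⟫) := by
      refine sum_le_sum fun i _ => sum_le_sum fun j _ => ?_
      have h : α i j t * ⟪gradient V (x i t - x j t), x' i t⟫
          + α j i t * ⟪gradient V (x j t - x i t), x' j t⟫ = α i j t * deriv (W i j) t := by
        rw [hαsymm j i, ← neg_sub (x i t) (x j t), gradient_neg_of_even hVd hVeven,
          inner_neg_left, congrFun (hWd i j) t, inner_sub_right]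
        ring
      rw [h]
      exact mul_max_add_mul_min_le (hαbound i j t).1 (hαbound i j t).2
    linarith
  have hkin : ∫ τ in (0:ℝ)..T, ∑ i, ⟪m i • x'' i τ, x' i τ⟫
      = ∑ i, m i / 2 * (‖x' i T‖ ^ 2 - ‖x' i 0‖ ^ 2) := by
    rw [intervalIntegral.integral_finsetSum fun i _ =>
      ((hmxc i).inner (hx'c i)).intervalIntegrable _ _]
    refine sum_congr rfl fun i _ => ?_
    rw [mul_sub]
    refine intervalIntegral.integral_eq_sub_of_hasDerivAt
      (f := fun t => m i / 2 * ‖x' i t‖ ^ 2) (fun t _ => ?_)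
      (((hmxc i).inner (hx'c i)).intervalIntegrable _ _)
    have h : ⟪m i • x'' i t, x' i t⟫ = m i / 2 * (2 * ⟪x' i t, x'' i t⟫) := by
      rw [real_inner_smul_left, real_inner_comm]
      ring
    rw [h]
    exact ((hx'' i t).norm_sq).const_mul (m i / 2)
  have hmaxc : ∀ i j, Continuous fun τ => max (deriv (W i j) τ) 0 := fun i j =>
    (hWc i j).max continuous_const
  have hminc : ∀ i j, Continuous fun τ => min (deriv (W i j) τ) 0 := fun i j =>
    (hWc i j).min continuous_const
  have hpair : ∫ τ in (0:ℝ)..T, ∑ i, ∑ j ∈ Ioi i,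
        (αm * max (deriv (W i j) τ) 0 + αM * min (deriv (W i j) τ) 0)
      = αm * (∑ i, ∑ j ∈ Ioi i,
          ∫ τ in {τ : ℝ | τ ∈ Set.Icc (0:ℝ) T ∧ 0 ≤ deriv (W i j) τ}, deriv (W i j) τ)
        + αM * (∑ i, ∑ j ∈ Ioi i,
          ∫ τ in {τ : ℝ | τ ∈ Set.Icc (0:ℝ) T ∧ deriv (W i j) τ < 0}, deriv (W i j) τ) := by
    rw [intervalIntegral.integral_finsetSum fun i _ =>
      Continuous.intervalIntegrable (by fun_prop) _ _]
    simp only [mul_sum, ← sum_add_distrib]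
    refine sum_congr rfl fun i _ => ?_
    rw [intervalIntegral.integral_finsetSum fun j _ =>
      Continuous.intervalIntegrable (by fun_prop) _ _]
    refine sum_congr rfl fun j _ => ?_
    rw [setIntegral_nonneg_eq_intervalIntegral_max (hWc i j) hT,
      setIntegral_neg_eq_intervalIntegral_min (hWc i j) hT,
      intervalIntegral.integral_add (((hmaxc i j).const_mul αm).intervalIntegrable _ _)
        (((hminc i j).const_mul αM).intervalIntegrable _ _),
      intervalIntegral.integral_const_mul, intervalIntegral.integral_const_mul]
  have hkinc : Continuous fun t => ∑ i, ⟪m i • x'' i t, x' i t⟫ :=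
    continuous_finsetSum _ fun i _ => (hmxc i).inner (hx'c i)
  have hpairc : Continuous fun t => ∑ i, ∑ j ∈ Ioi i,
      (αm * max (deriv (W i j) t) 0 + αM * min (deriv (W i j) t) 0) := by fun_prop
  rw [add_assoc, ← hkin, ← hpair, ← intervalIntegral.integral_add
    (hkinc.intervalIntegrable _ _) (hpairc.intervalIntegrable _ _)]
  exact intervalIntegral.integral_mono_on hT ((hkinc.add hpairc).intervalIntegrable _ _)
    (Continuous.intervalIntegrable (by fun_prop) _ _) fun t _ => hpow t
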